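/- For every formula α, the sequents α ∧ ¬α ⇒ α ∧ ¬□α and α ∧ ¬□α ⇒ α ∧ ¬α are both derivable in SC_TML. -/

import Mathlib

/-- Formulas built from propositional variables by the connectives `∧`, `∨`, `¬`, `□`
(no `⊥`). -/
inductive Formula : Type where
  | var : ℕ → Formula
  | and : Formula → Formula → Formula
  | or : Formula → Formula → Formula
  | neg : Formula → Formula
  | box : Formula → Formula
deriving DecidableEq
/-- The two-sided sequent calculus `SC_TML`.  `SCder c Γ Δ` means the sequent `Γ ⇒ Δ`
has a derivation; when `c = false` the cut rule is not allowed (cut-free derivability),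
`SCder true` is plain derivability. -/
inductive SCder : Bool → Finset Formula → Finset Formula → Prop where
  | ax (c : Bool) (α : Formula) : SCder c {α} {α}
  | weakL {c Γ Δ} (α : Formula) : SCder c Γ Δ → SCder c (insert α Γ) Δ
  | weakR {c Γ Δ} (α : Formula) : SCder c Γ Δ → SCder c Γ (insert α Δ)
  | cut {Γ Δ : Finset Formula} {α : Formula} :
      SCder true Γ (insert α Δ) → SCder true (insert α Γ) Δ → SCder true Γ Δ
  | andL {c Γ Δ} (α β : Formula) :
      SCder c (insert α (insert β Γ)) Δ → SCder c (insert (α.and β) Γ) Δ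
  | andR {c Γ Δ} (α β : Formula) :
      SCder c Γ (insert α Δ) → SCder c Γ (insert β Δ) → SCder c Γ (insert (α.and β) Δ)
  | nandL {c Γ Δ} (α β : Formula) :
      SCder c (insert α.neg Γ) Δ → SCder c (insert β.neg Γ) Δ →
      SCder c (insert (α.and β).neg Γ) Δ
  | nandR {c Γ Δ} (α β : Formula) :
      SCder c Γ (insert α.neg (insert β.neg Δ)) → SCder c Γ (insert (α.and β).neg Δ)
  | orL {c Γ Δ} (α β : Formula) :
      SCder c (insert α Γ) Δ → SCder c (insert β Γ) Δ → SCder c (insert (α.or β) Γ) Δ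
  | orR {c Γ Δ} (α β : Formula) :
      SCder c Γ (insert α (insert β Δ)) → SCder c Γ (insert (α.or β) Δ)
  | norL {c Γ Δ} (α β : Formula) :
      SCder c (insert α.neg (insert β.neg Γ)) Δ → SCder c (insert (α.or β).neg Γ) Δ
  | norR {c Γ Δ} (α β : Formula) :
      SCder c Γ (insert α.neg Δ) → SCder c Γ (insert β.neg Δ) →
      SCder c Γ (insert (α.or β).neg Δ)
  | nnL {c Γ Δ} (α : Formula) : SCder c (insert α Γ) Δ → SCder c (insert α.neg.neg Γ) Δ
  | nnR {c Γ Δ} (α : Formula) : SCder c Γ (insert α Δ) → SCder c Γ (insert α.neg.neg Δ)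
  | boxL1 {c Γ Δ} (α : Formula) : SCder c (insert α Γ) Δ → SCder c (insert α.box Γ) Δ
  | boxL2 {c Γ Δ} (α : Formula) : SCder c Γ (insert α.neg Δ) → SCder c (insert α.box Γ) Δ
  | boxR {c Γ Δ} (α : Formula) :
      SCder c Γ (insert α Δ) → SCder c (insert α.neg Γ) Δ → SCder c Γ (insert α.box Δ)
  | nboxL {c Γ Δ} (α : Formula) :
      SCder c Γ (insert α Δ) → SCder c (insert α.neg Γ) Δ → SCder c (insert α.box.neg Γ) Δ
  | nboxR1 {c Γ Δ} (α : Formula) : SCder c (insert α Γ) Δ → SCder c Γ (insert α.box.neg Δ)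
  | nboxR2 {c Γ Δ} (α : Formula) : SCder c Γ (insert α.neg Δ) → SCder c Γ (insert α.box.neg Δ)

/-- `α ∧ ¬α ⇔ α ∧ ¬□α` in `SC_TML`. -/
theorem sc_and_neg_box_equiv (α : Formula) :
    SCder true {α.and α.neg} {α.and α.box.neg} ∧
    SCder true {α.and α.box.neg} {α.and α.neg} := by
  have pair {a b : Formula} {Δ} (h : SCder true (insert a {b}) Δ) :
      SCder true {a.and b} Δ := by
    have := SCder.andL (Γ := ∅) a b (by simpa using h)
    simpa using this
  have conj {a b : Formula} {Γ} (ha : SCder true Γ {a}) (hb : SCder true Γ {b}) :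
      SCder true Γ {a.and b} := by
    have := SCder.andR (Δ := ∅) a b (by simpa using ha) (by simpa using hb)
    simpa using this
  have left (a b : Formula) : SCder true (insert a {b}) {a} := by
    rw [Finset.pair_comm]
    exact .weakL b (.ax true a)
  have right (a b : Formula) : SCder true (insert a {b}) {b} := .weakL a (.ax true b)
  refine ⟨pair (conj (left _ _) ?_), pair (conj (left _ _) ?_)⟩
  · have := SCder.nboxR2 (Δ := ∅) α (by simpa using right α α.neg)
    simpa using this
  · rw [Finset.pair_comm]
    refine .nboxL α ?_ (left α.neg α)
    rw [Finset.pair_comm]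
    exact .weakR α.neg (.ax true α)
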